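/- The restriction of the twisted adjoint representation ρ to Pin(n) is a surjective group homomorphism ρ : Pin(n) → O(n) with kernel {−1, 1}, and the restriction of ρ to Spin(n) is a surjective group homomorphism onto SO(n) with kernel {−1, 1}. -/

import Mathlib

open CliffordAlgebra

/-- The negative-definite quadratic form `Φ(x₁,…,xₙ) = −(x₁² + ⋯ + xₙ²)` on `ℝⁿ`. -/
noncomputable def negDefQF (n : ℕ) : QuadraticForm ℝ (Fin n → ℝ) :=
  QuadraticMap.weightedSumSquares ℝ (fun _ : Fin n => (-1 : ℝ))

/-- Membership in `Pin(n)`: `x` lies in the Clifford group `Γₙ` (twisted conjugation maps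
`ℝⁿ` into `ℝⁿ`) and has norm `N(x) = x·x̄ = 1`. -/
def InPin (n : ℕ) (x : (CliffordAlgebra (negDefQF n))ˣ) : Prop :=
  (∀ v : Fin n → ℝ,
    involute (x : CliffordAlgebra (negDefQF n)) * ι (negDefQF n) v * ↑x⁻¹ ∈
      Set.range (ι (negDefQF n))) ∧
  (x : CliffordAlgebra (negDefQF n)) * reverse (involute (x : CliffordAlgebra (negDefQF n))) = 1

/-- Membership in `Spin(n)`: membership in `Pin(n)` together with evenness. -/
def InSpin (n : ℕ) (x : (CliffordAlgebra (negDefQF n))ˣ) : Prop :=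
  InPin n x ∧ (x : CliffordAlgebra (negDefQF n)) ∈ evenOdd (negDefQF n) 0

namespace CliffordAlgebra

section Exterior

variable {R M : Type*} [CommRing R] [AddCommGroup M] [Module R M]

/-- In the exterior algebra, `x - v ∧ (d⌋x)` is the image of `x` under the map induced by
`w ↦ w - d w • v`. -/
theorem _root_.ExteriorAlgebra.map_id_sub_smulRight (d : Module.Dual R M) (v : M)
    (x : ExteriorAlgebra R M) :
    ExteriorAlgebra.map (LinearMap.id - d.smulRight v) x =
      x - ExteriorAlgebra.ι R v * contractLeft (Q := 0) d x := by
  induction x using CliffordAlgebra.left_induction with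
  | algebraMap r => simp [contractLeft_algebraMap, AlgHom.commutes]
  | add x y hx hy => rw [map_add, hx, hy, map_add]; noncomm_ring
  | ι_mul x m hx =>
    have hvv (y : ExteriorAlgebra R M) :
        ExteriorAlgebra.ι R v * (ExteriorAlgebra.ι R v * y) = 0 := by
      rw [← mul_assoc, ExteriorAlgebra.ι_sq_zero, zero_mul]
    have hvm (y : ExteriorAlgebra R M) : ExteriorAlgebra.ι R v * (ExteriorAlgebra.ι R m * y) =
        -(ExteriorAlgebra.ι R m * (ExteriorAlgebra.ι R v * y)) := by
      rw [← mul_assoc, ← mul_assoc,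
        eq_neg_of_add_eq_zero_left (ExteriorAlgebra.ι_add_mul_swap v m), neg_mul]
    change ExteriorAlgebra.map _ (ExteriorAlgebra.ι R m * x) = ExteriorAlgebra.ι R m * x -
      ExteriorAlgebra.ι R v * contractLeft (Q := 0) d (CliffordAlgebra.ι 0 m * x)
    rw [map_mul, hx, ExteriorAlgebra.map_apply_ι, contractLeft_ι_mul]
    change ExteriorAlgebra.ι R (m - d m • v) * _ = _ - _ * (_ - ExteriorAlgebra.ι R m * _)
    simp only [map_sub, map_smul, sub_mul, mul_sub, smul_mul_assoc, mul_smul_comm, hvv, hvm,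
      smul_zero]
    abel

/-- An element of the exterior algebra of a finite free module annihilated by all contractions is
a scalar. -/
theorem _root_.ExteriorAlgebra.mem_range_algebraMap_of_contractLeft_eq_zero {κ : Type*} [Finite κ]
    (b : Module.Basis κ R M) (x : ExteriorAlgebra R M)
    (hx : ∀ d : Module.Dual R M, contractLeft (Q := 0) d x = 0) :
    x ∈ Set.range (algebraMap R (ExteriorAlgebra R M)) := by
  classical
  have := Fintype.ofFinite κ
  have key (s : Finset κ) :
      ExteriorAlgebra.map (LinearMap.id - ∑ i ∈ s, (b.coord i).smulRight (b i)) x = x := by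
    induction s using Finset.induction_on with
    | empty => simp
    | insert i s hi ih =>
      have hcomp : LinearMap.id - ∑ j ∈ insert i s, (b.coord j).smulRight (b j) =
          (LinearMap.id - (b.coord i).smulRight (b i)) ∘ₗ
            (LinearMap.id - ∑ j ∈ s, (b.coord j).smulRight (b j)) := by
        ext v
        simp [Finset.sum_insert hi, LinearMap.sum_apply, Finsupp.single_apply, hi]
        abel
      rw [hcomp, ← ExteriorAlgebra.map_comp_map, AlgHom.comp_apply, ih,
        ExteriorAlgebra.map_id_sub_smulRight, hx, mul_zero, sub_zero]
  have hzero : LinearMap.id - ∑ i, (b.coord i).smulRight (b i) = (0 : M →ₗ[R] M) := by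
    ext v
    simp [LinearMap.sum_apply, b.sum_repr]
  have hmap : ExteriorAlgebra.map (0 : M →ₗ[R] M) =
      (Algebra.ofId R _).comp ExteriorAlgebra.algebraMapInv := by
    ext v
    simp [ExteriorAlgebra.algebraMapInv]
  have h := key Finset.univ
  rw [hzero, hmap] at h
  exact ⟨_, h⟩

end Exterior

section CliffordGroup

variable {R M : Type*} [CommRing R] [AddCommGroup M] [Module R M] {Q : QuadraticForm R M}

theorem ι_injective [Invertible (2 : R)] : Function.Injective (ι Q) := fun v w h => by
  have h' := congrArg (equivExterior Q) h
  simp only [equivExterior, changeFormEquiv_apply, changeForm_ι] at h'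
  exact (ExteriorAlgebra.ι_inj R v w).1 h'

theorem mem_range_algebraMap_of_contractLeft_eq_zero [Invertible (2 : R)] {κ : Type*} [Finite κ]
    (b : Module.Basis κ R M) (x : CliffordAlgebra Q)
    (hx : ∀ d : Module.Dual R M, contractLeft d x = 0) :
    x ∈ Set.range (algebraMap R (CliffordAlgebra Q)) := by
  obtain ⟨r, hr⟩ := ExteriorAlgebra.mem_range_algebraMap_of_contractLeft_eq_zero b
    (equivExterior Q x) fun d => by
      simp only [equivExterior, changeFormEquiv_apply, ← changeForm_contractLeft, hx, map_zero]
  refine ⟨r, (equivExterior Q).injective ?_⟩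
  rw [← hr]
  simp only [equivExterior, changeFormEquiv_apply, changeForm_algebraMap]

/-- The twisted commutator with a vector is a contraction. -/
theorem ι_mul_sub_involute_mul_ι (v : M) (x : CliffordAlgebra Q) :
    ι Q v * x - involute x * ι Q v = contractLeft (QuadraticMap.polarBilin Q v) x := by
  induction x using CliffordAlgebra.left_induction with
  | algebraMap r => rw [AlgHom.commutes, contractLeft_algebraMap, Algebra.commutes, sub_self]
  | add x y hx hy => rw [map_add, map_add, ← hx, ← hy]; noncomm_ring
  | ι_mul x m hx =>
    rw [contractLeft_ι_mul, ← hx, map_mul, involute_ι, QuadraticMap.polarBilin_apply_apply,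
      Algebra.smul_def, ← ι_mul_ι_add_swap]
    noncomm_ring

/-- The kernel of the twisted adjoint action consists of scalars. -/
theorem mem_range_algebraMap_of_involute_mul_ι [Invertible (2 : R)] {κ : Type*} [Finite κ]
    (b : Module.Basis κ R M) (hQ : Function.Surjective (QuadraticMap.polarBilin Q))
    (x : CliffordAlgebra Q) (hx : ∀ v, involute x * ι Q v = ι Q v * x) :
    x ∈ Set.range (algebraMap R (CliffordAlgebra Q)) :=
  mem_range_algebraMap_of_contractLeft_eq_zero b x fun d => by
    obtain ⟨v, rfl⟩ := hQ d
    rw [← ι_mul_sub_involute_mul_ι, hx, sub_self]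

/-- Two units with the same twisted adjoint action differ by a scalar. -/
theorem exists_eq_smul_of_twistedConj_eq [Invertible (2 : R)] {κ : Type*} [Finite κ]
    (b : Module.Basis κ R M) (hQ : Function.Surjective (QuadraticMap.polarBilin Q))
    (x y : (CliffordAlgebra Q)ˣ)
    (h : ∀ v, involute (x : CliffordAlgebra Q) * ι Q v * ↑x⁻¹ =
      involute (y : CliffordAlgebra Q) * ι Q v * ↑y⁻¹) :
    ∃ r : R, (x : CliffordAlgebra Q) = r • (y : CliffordAlgebra Q) := by
  obtain ⟨r, hr⟩ := mem_range_algebraMap_of_involute_mul_ι b hQ (↑y⁻¹ * ↑x : CliffordAlgebra Q)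
    fun v => by
      have hy : involute (↑y⁻¹ : CliffordAlgebra Q) * involute (y : CliffordAlgebra Q) = 1 := by
        rw [← map_mul, Units.inv_mul, map_one]
      calc involute (↑y⁻¹ * ↑x : CliffordAlgebra Q) * ι Q v
          = involute (↑y⁻¹ : CliffordAlgebra Q) *
              (involute (x : CliffordAlgebra Q) * ι Q v * ↑x⁻¹) * ↑x := by
            simp only [map_mul, mul_assoc, Units.inv_mul, mul_one]
        _ = involute (↑y⁻¹ : CliffordAlgebra Q) * involute (y : CliffordAlgebra Q) *
              ι Q v * (↑y⁻¹ * ↑x) := by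
            rw [h]; simp only [mul_assoc]
        _ = ι Q v * (↑y⁻¹ * ↑x) := by rw [hy, one_mul]
  refine ⟨r, ?_⟩
  rw [Algebra.smul_def, Algebra.commutes, hr, Units.mul_inv_cancel_left]

theorem twistedConj_mul (x y : (CliffordAlgebra Q)ˣ) (v : M) :
    involute ((x * y : (CliffordAlgebra Q)ˣ) : CliffordAlgebra Q) * ι Q v * ↑(x * y)⁻¹ =
      involute (x : CliffordAlgebra Q) *
        (involute (y : CliffordAlgebra Q) * ι Q v * ↑y⁻¹) * ↑x⁻¹ := by
  simp only [Units.val_mul, map_mul, mul_inv_rev, mul_assoc]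

/-- A vector obtained by twisted conjugation has the same square. -/
theorem quadraticForm_eq_of_twistedConj_eq [FaithfulSMul R (CliffordAlgebra Q)]
    (x : (CliffordAlgebra Q)ˣ) (v w : M)
    (h : involute (x : CliffordAlgebra Q) * ι Q v * ↑x⁻¹ = ι Q w) : Q w = Q v := by
  have hxx : involute (x : CliffordAlgebra Q) * involute (↑x⁻¹ : CliffordAlgebra Q) = 1 := by
    rw [← map_mul, Units.mul_inv, map_one]
  have h' : (x : CliffordAlgebra Q) * ι Q v * involute (↑x⁻¹ : CliffordAlgebra Q) = ι Q w := by
    have := congrArg involute h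
    simpa only [map_mul, involute_involute, involute_ι, mul_neg, neg_mul, neg_inj] using this
  apply FaithfulSMul.algebraMap_injective R (CliffordAlgebra Q)
  calc algebraMap R (CliffordAlgebra Q) (Q w)
      = involute (x : CliffordAlgebra Q) * ι Q v * ↑x⁻¹ *
          (↑x * ι Q v * involute (↑x⁻¹ : CliffordAlgebra Q)) := by rw [h, h', ι_sq_scalar]
    _ = involute (x : CliffordAlgebra Q) * (ι Q v * ι Q v) *
          involute (↑x⁻¹ : CliffordAlgebra Q) := by
        simp only [mul_assoc, Units.inv_mul_cancel_left]
    _ = algebraMap R (CliffordAlgebra Q) (Q v) := by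
        rw [ι_sq_scalar, ← Algebra.commutes, mul_assoc, hxx, mul_one]

/-- The twisted adjoint action of an element of the Clifford group is linear. -/
theorem exists_linearMap_twistedConj_eq [Invertible (2 : R)] (x : (CliffordAlgebra Q)ˣ)
    (hx : ∀ v, involute (x : CliffordAlgebra Q) * ι Q v * ↑x⁻¹ ∈ Set.range (ι Q)) :
    ∃ f : M →ₗ[R] M, ∀ v, involute (x : CliffordAlgebra Q) * ι Q v * ↑x⁻¹ = ι Q (f v) := by
  choose f hf using hx
  refine ⟨{ toFun := f, map_add' := fun v w => ι_injective (Q := Q) ?_,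
            map_smul' := fun r v => ι_injective (Q := Q) ?_ }, fun v => (hf v).symm⟩
  · rw [hf, map_add, map_add, hf, hf, mul_add, add_mul]
  · rw [RingHom.id_apply, hf, map_smul, map_smul, hf, mul_smul_comm, smul_mul_assoc]

end CliffordGroup

end CliffordAlgebra

section PinSpin

variable {n : ℕ}

theorem negDefQF_apply (v : Fin n → ℝ) : negDefQF n v = -∑ i, v i * v i := by
  simp [negDefQF, QuadraticMap.weightedSumSquares_apply]

theorem polar_negDefQF (v w : Fin n → ℝ) :
    QuadraticMap.polar (negDefQF n) v w = -2 * ∑ i, v i * w i := by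
  simp only [QuadraticMap.polar, negDefQF_apply, Finset.mul_sum, ← Finset.sum_neg_distrib,
    ← Finset.sum_sub_distrib]
  exact Finset.sum_congr rfl fun i _ => by simp only [Pi.add_apply]; ring

theorem polarBilin_negDefQF_surjective :
    Function.Surjective (QuadraticMap.polarBilin (negDefQF n)) := fun d => by
  refine ⟨fun i => -(1 / 2) * d (Pi.single i 1), LinearMap.pi_ext' fun i => LinearMap.ext_ring ?_⟩
  simp only [LinearMap.comp_apply, LinearMap.single_apply, QuadraticMap.polarBilin_apply_apply,
    polar_negDefQF]
  rw [Finset.sum_eq_single i (fun j _ hj => by simp [hj]) (by simp), Pi.single_eq_same]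
  ring

theorem negDefQF_ofLp (v : EuclideanSpace ℝ (Fin n)) : negDefQF n v.ofLp = -‖v‖ ^ 2 := by
  rw [negDefQF_apply, EuclideanSpace.norm_sq_eq]
  simp [sq]

theorem InPin.mul {x y : (CliffordAlgebra (negDefQF n))ˣ} (hx : InPin n x) (hy : InPin n y) :
    InPin n (x * y) := by
  refine ⟨fun v => ?_, ?_⟩
  · obtain ⟨w, hw⟩ := hy.1 v
    rw [twistedConj_mul, ← hw]
    exact hx.1 w
  · rw [Units.val_mul, map_mul, reverse.map_mul, mul_assoc, ← mul_assoc (↑y : CliffordAlgebra (negDefQF n)),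
      hy.2, one_mul, hx.2]

theorem InPin.one : InPin n 1 := by
  refine ⟨fun v => ⟨v, by simp⟩, by simp⟩

theorem InPin.sq_eq_one_of_eq_smul {x y : (CliffordAlgebra (negDefQF n))ˣ} (hx : InPin n x)
    (hy : InPin n y) {r : ℝ}
    (h : (x : CliffordAlgebra (negDefQF n)) = r • (y : CliffordAlgebra (negDefQF n))) :
    r ^ 2 = 1 := by
  have h1 := hx.2
  rw [h, map_smul, map_smul, smul_mul_smul_comm, hy.2, ← Algebra.algebraMap_eq_smul_one] at h1
  rw [sq]
  exact (algebraMap ℝ (CliffordAlgebra (negDefQF n))).injective (h1.trans (map_one _).symm)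

/-- The reflection in the hyperplane orthogonal to a unit vector is the twisted adjoint action of
that vector. -/
theorem exists_inPin_reflection (u : EuclideanSpace ℝ (Fin n)) (hu : ‖u‖ = 1) :
    ∃ x : (CliffordAlgebra (negDefQF n))ˣ, InPin n x ∧
      (x : CliffordAlgebra (negDefQF n)) = ι (negDefQF n) u.ofLp ∧
      ∀ v : EuclideanSpace ℝ (Fin n),
        involute (x : CliffordAlgebra (negDefQF n)) * ι (negDefQF n) v.ofLp * ↑x⁻¹ =
          ι (negDefQF n) ((ℝ ∙ u)ᗮ.reflection v).ofLp := by
  have hQ : negDefQF n u.ofLp = -1 := by rw [negDefQF_ofLp, hu]; norm_num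
  have hsq : ι (negDefQF n) u.ofLp * ι (negDefQF n) u.ofLp = -1 := by
    rw [ι_sq_scalar, hQ, map_neg, map_one]
  let x : (CliffordAlgebra (negDefQF n))ˣ :=
    ⟨ι (negDefQF n) u.ofLp, -ι (negDefQF n) u.ofLp, by rw [mul_neg, hsq, neg_neg],
      by rw [neg_mul, hsq, neg_neg]⟩
  have hx (v : EuclideanSpace ℝ (Fin n)) :
      involute (x : CliffordAlgebra (negDefQF n)) * ι (negDefQF n) v.ofLp * ↑x⁻¹ =
        ι (negDefQF n) ((ℝ ∙ u)ᗮ.reflection v).ofLp := by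
    change involute (ι (negDefQF n) u.ofLp) * ι (negDefQF n) v.ofLp * -ι (negDefQF n) u.ofLp = _
    rw [involute_ι, neg_mul, neg_mul_neg, ι_mul_ι_mul_ι, hQ, polar_negDefQF,
      Submodule.reflection_orthogonal_apply, Submodule.reflection_singleton_apply, hu]
    congr 1
    ext i
    simp [PiLp.inner_apply, mul_comm]
    ring
  refine ⟨x, ⟨fun v => ⟨_, (hx (WithLp.toLp 2 v)).symm⟩, ?_⟩, rfl, hx⟩
  change ι (negDefQF n) u.ofLp * reverse (involute (ι (negDefQF n) u.ofLp)) = 1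
  rw [involute_ι, map_neg, reverse_ι, mul_neg, hsq, neg_neg]

/-- Every linear isometry is the twisted adjoint action of an element of the Pin group, whose
parity is detected by the determinant. -/
theorem exists_inPin_of_linearIsometryEquiv
    (φ : EuclideanSpace ℝ (Fin n) ≃ₗᵢ[ℝ] EuclideanSpace ℝ (Fin n)) :
    ∃ (x : (CliffordAlgebra (negDefQF n))ˣ) (k : ℕ), InPin n x ∧
      (x : CliffordAlgebra (negDefQF n)) ∈ evenOdd (negDefQF n) k ∧
      LinearMap.det (φ.toLinearEquiv : EuclideanSpace ℝ (Fin n) →ₗ[ℝ] _) = (-1) ^ k ∧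
      ∀ v : EuclideanSpace ℝ (Fin n),
        involute (x : CliffordAlgebra (negDefQF n)) * ι (negDefQF n) v.ofLp * ↑x⁻¹ =
          ι (negDefQF n) (φ v).ofLp := by
  have hone : ((1 : (CliffordAlgebra (negDefQF n))ˣ) : CliffordAlgebra (negDefQF n)) ∈
      evenOdd (negDefQF n) ((0 : ℕ) : ZMod 2) := by
    simpa using SetLike.one_mem_graded (evenOdd (negDefQF n))
  obtain ⟨l, -, rfl⟩ := φ.reflections_generate_dim
  induction l with
  | nil =>
    refine ⟨1, 0, InPin.one, hone, ?_, fun v => by simp⟩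
    exact LinearMap.det_id
  | cons v l ih =>
    obtain ⟨y, k, hy, hyk, hdet, hyv⟩ := ih
    rw [List.map_cons, List.prod_cons]
    set ψ := (l.map fun v => (ℝ ∙ v)ᗮ.reflection).prod
    by_cases hv : v = 0
    · subst hv
      have h1 : (ℝ ∙ (0 : EuclideanSpace ℝ (Fin n)))ᗮ.reflection = 1 := by
        refine LinearIsometryEquiv.ext fun w => ?_
        exact Submodule.reflection_mem_subspace_eq_self (by simp)
      rw [h1, one_mul]
      exact ⟨y, k, hy, hyk, hdet, hyv⟩
    · have hspan : (ℝ ∙ ((‖v‖⁻¹ : ℝ) • v)) = ℝ ∙ v :=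
        Submodule.span_singleton_smul_eq (IsUnit.mk0 _ (by simpa using hv)) v
      obtain ⟨x, hx, hxv, hxw⟩ := exists_inPin_reflection ((‖v‖⁻¹ : ℝ) • v)
        (norm_smul_inv_norm (𝕜 := ℝ) hv)
      simp only [hspan] at hxw
      refine ⟨x * y, k + 1, hx.mul hy, ?_, ?_, fun w => ?_⟩
      · rw [Units.val_mul, Nat.cast_add, Nat.cast_one, add_comm]
        exact SetLike.mul_mem_graded (hxv ▸ ι_mem_evenOdd_one _ _) hyk
      · have hr : LinearMap.det ((ℝ ∙ v)ᗮ.reflection.toLinearMap) = -1 := by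
          rw [Submodule.det_reflection, Submodule.orthogonal_orthogonal, finrank_span_singleton hv,
            pow_one]
        have hmul : (((ℝ ∙ v)ᗮ.reflection * ψ).toLinearEquiv : EuclideanSpace ℝ (Fin n) →ₗ[ℝ] _) =
            (ℝ ∙ v)ᗮ.reflection.toLinearMap ∘ₗ
              (ψ.toLinearEquiv : EuclideanSpace ℝ (Fin n) →ₗ[ℝ] _) := rfl
        rw [hmul, LinearMap.det_comp, hdet, hr, pow_succ']
      · rw [twistedConj_mul, hyv, hxw]
        rfl

/-- Every isometry of `negDefQF n` is the twisted adjoint action of an element of the Pin group,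
whose parity is detected by the determinant. -/
theorem exists_inPin_of_isometry (f : (Fin n → ℝ) →ₗ[ℝ] (Fin n → ℝ))
    (hf : ∀ v, negDefQF n (f v) = negDefQF n v) :
    ∃ (x : (CliffordAlgebra (negDefQF n))ˣ) (k : ℕ), InPin n x ∧
      (x : CliffordAlgebra (negDefQF n)) ∈ evenOdd (negDefQF n) k ∧
      LinearMap.det f = (-1) ^ k ∧
      ∀ v, involute (x : CliffordAlgebra (negDefQF n)) * ι (negDefQF n) v * ↑x⁻¹ =
        ι (negDefQF n) (f v) := by
  let e : (Fin n → ℝ) ≃ₗ[ℝ] EuclideanSpace ℝ (Fin n) := (WithLp.linearEquiv 2 ℝ (Fin n → ℝ)).symm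
  let g : EuclideanSpace ℝ (Fin n) →ₗᵢ[ℝ] EuclideanSpace ℝ (Fin n) :=
    { toLinearMap := e ∘ₗ f ∘ₗ e.symm
      norm_map' := fun v => by
        have h := hf v.ofLp
        have h' := negDefQF_ofLp (e (f v.ofLp))
        change negDefQF n (f v.ofLp) = _ at h'
        rw [h', negDefQF_ofLp, neg_inj] at h
        exact (sq_eq_sq₀ (norm_nonneg _) (norm_nonneg _)).1 h }
  obtain ⟨x, k, hx, hxk, hdet, hxv⟩ :=
    exists_inPin_of_linearIsometryEquiv (g.toLinearIsometryEquiv rfl)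
  refine ⟨x, k, hx, hxk, ?_, fun v => hxv (WithLp.toLp 2 v)⟩
  rw [← hdet, ← LinearMap.det_conj f e]
  rfl

/-- Elements of the Pin group with the same twisted adjoint action agree up to sign. -/
theorem InPin.eq_or_eq_neg {x y : (CliffordAlgebra (negDefQF n))ˣ} (hx : InPin n x)
    (hy : InPin n y)
    (h : ∀ v, involute (x : CliffordAlgebra (negDefQF n)) * ι (negDefQF n) v * ↑x⁻¹ =
      involute (y : CliffordAlgebra (negDefQF n)) * ι (negDefQF n) v * ↑y⁻¹) :
    (x : CliffordAlgebra (negDefQF n)) = y ∨ (x : CliffordAlgebra (negDefQF n)) = -y := by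
  obtain ⟨r, hr⟩ :=
    exists_eq_smul_of_twistedConj_eq (Pi.basisFun ℝ (Fin n)) polarBilin_negDefQF_surjective x y h
  rcases sq_eq_one_iff.1 (hx.sq_eq_one_of_eq_smul hy hr) with rfl | rfl
  · exact Or.inl (by rw [hr, one_smul])
  · exact Or.inr (by rw [hr, neg_smul, one_smul])

theorem InPin.twistedConj_eq_iff {x : (CliffordAlgebra (negDefQF n))ˣ} (hx : InPin n x) :
    (∀ v, involute (x : CliffordAlgebra (negDefQF n)) * ι (negDefQF n) v * ↑x⁻¹ =
      ι (negDefQF n) v) ↔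
      ((x : CliffordAlgebra (negDefQF n)) = 1 ∨ (x : CliffordAlgebra (negDefQF n)) = -1) := by
  refine ⟨fun h => hx.eq_or_eq_neg InPin.one fun v => by simpa using h v, ?_⟩
  rintro (h | h) v
  · obtain rfl : x = 1 := Units.ext h
    simp
  · obtain rfl : x = -1 := Units.ext h
    simp

theorem InPin.exists_isometry {x : (CliffordAlgebra (negDefQF n))ˣ} (hx : InPin n x) :
    ∃ f : (Fin n → ℝ) →ₗ[ℝ] (Fin n → ℝ), (∀ v, negDefQF n (f v) = negDefQF n v) ∧
      ∀ v, involute (x : CliffordAlgebra (negDefQF n)) * ι (negDefQF n) v * ↑x⁻¹ =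
        ι (negDefQF n) (f v) := by
  obtain ⟨f, hf⟩ := exists_linearMap_twistedConj_eq x hx.1
  exact ⟨f, fun v => quadraticForm_eq_of_twistedConj_eq x v (f v) (hf v), hf⟩

/-- A unit of a Clifford algebra cannot be both even and odd. -/
theorem not_mem_evenOdd_one_of_mem_evenOdd_zero (x : (CliffordAlgebra (negDefQF n))ˣ)
    (hx : (x : CliffordAlgebra (negDefQF n)) ∈ evenOdd (negDefQF n) 0) :
    (x : CliffordAlgebra (negDefQF n)) ∉ evenOdd (negDefQF n) 1 := fun h =>
  x.ne_zero (Submodule.disjoint_def.1 (evenOdd_isCompl (negDefQF n)).disjoint _ hx h)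

theorem InSpin.exists_isometry {x : (CliffordAlgebra (negDefQF n))ˣ} (hx : InSpin n x) :
    ∃ f : (Fin n → ℝ) →ₗ[ℝ] (Fin n → ℝ), (∀ v, negDefQF n (f v) = negDefQF n v) ∧
      LinearMap.det f = 1 ∧
      ∀ v, involute (x : CliffordAlgebra (negDefQF n)) * ι (negDefQF n) v * ↑x⁻¹ =
        ι (negDefQF n) (f v) := by
  obtain ⟨f, hf, hxf⟩ := hx.1.exists_isometry
  obtain ⟨y, k, hy, hyk, hdet, hyf⟩ := exists_inPin_of_isometry f hf
  refine ⟨f, hf, ?_, hxf⟩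
  have hxk : (x : CliffordAlgebra (negDefQF n)) ∈ evenOdd (negDefQF n) k := by
    rcases hx.1.eq_or_eq_neg hy fun v => (hxf v).trans (hyf v).symm with h | h
    · rwa [h]
    · rw [h]; exact neg_mem hyk
  rcases Nat.even_or_odd k with hk | hk
  · rw [hdet, hk.neg_one_pow]
  · rw [ZMod.natCast_eq_one_iff_odd.2 hk] at hxk
    exact absurd hxk (not_mem_evenOdd_one_of_mem_evenOdd_zero x hx.2)

theorem exists_inSpin_of_isometry (f : (Fin n → ℝ) →ₗ[ℝ] (Fin n → ℝ))
    (hf : ∀ v, negDefQF n (f v) = negDefQF n v) (hdet : LinearMap.det f = 1) :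
    ∃ x : (CliffordAlgebra (negDefQF n))ˣ, InSpin n x ∧
      ∀ v, involute (x : CliffordAlgebra (negDefQF n)) * ι (negDefQF n) v * ↑x⁻¹ =
        ι (negDefQF n) (f v) := by
  obtain ⟨x, k, hx, hxk, hk, hxf⟩ := exists_inPin_of_isometry f hf
  have heven : Even k := by
    rw [hdet] at hk
    exact (neg_one_pow_eq_one_iff_even (by norm_num)).1 hk.symm
  rw [ZMod.natCast_eq_zero_iff_even.2 heven] at hxk
  exact ⟨x, ⟨hx, hxk⟩, hxf⟩

end PinSpin

/-- The restriction of the twisted adjoint representation `ρ(x)(v) = α(x) v x⁻¹` to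
`Pin(n)` is a surjective homomorphism onto `O(n)` with kernel `{−1, 1}`, and its
restriction to `Spin(n)` is a surjective homomorphism onto `SO(n)` with kernel `{−1, 1}`. -/
theorem pin_spin_surjective_kernel (n : ℕ) :
    -- ρ is a homomorphism
    (∀ x y : (CliffordAlgebra (negDefQF n))ˣ, InPin n x → InPin n y →
      ∀ v : Fin n → ℝ,
        involute ((x * y : (CliffordAlgebra (negDefQF n))ˣ) : CliffordAlgebra (negDefQF n)) *
            ι (negDefQF n) v * ↑(x * y)⁻¹ =
          involute (x : CliffordAlgebra (negDefQF n)) *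
            (involute (y : CliffordAlgebra (negDefQF n)) * ι (negDefQF n) v * ↑y⁻¹) * ↑x⁻¹) ∧
    -- ρ maps Pin(n) into O(n)
    (∀ x : (CliffordAlgebra (negDefQF n))ˣ, InPin n x →
      ∃ f : (Fin n → ℝ) →ₗ[ℝ] (Fin n → ℝ),
        (∀ v, negDefQF n (f v) = negDefQF n v) ∧
        ∀ v : Fin n → ℝ,
          involute (x : CliffordAlgebra (negDefQF n)) * ι (negDefQF n) v * ↑x⁻¹ =
            ι (negDefQF n) (f v)) ∧
    -- ρ : Pin(n) → O(n) is surjective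
    (∀ f : (Fin n → ℝ) →ₗ[ℝ] (Fin n → ℝ), (∀ v, negDefQF n (f v) = negDefQF n v) →
      ∃ x : (CliffordAlgebra (negDefQF n))ˣ, InPin n x ∧
        ∀ v : Fin n → ℝ,
          involute (x : CliffordAlgebra (negDefQF n)) * ι (negDefQF n) v * ↑x⁻¹ =
            ι (negDefQF n) (f v)) ∧
    -- the kernel of ρ on Pin(n) is {−1, 1}
    (∀ x : (CliffordAlgebra (negDefQF n))ˣ, InPin n x →
      ((∀ v : Fin n → ℝ,
          involute (x : CliffordAlgebra (negDefQF n)) * ι (negDefQF n) v * ↑x⁻¹ =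
            ι (negDefQF n) v) ↔
        ((x : CliffordAlgebra (negDefQF n)) = 1 ∨
          (x : CliffordAlgebra (negDefQF n)) = -1))) ∧
    -- ρ maps Spin(n) into SO(n)
    (∀ x : (CliffordAlgebra (negDefQF n))ˣ, InSpin n x →
      ∃ f : (Fin n → ℝ) →ₗ[ℝ] (Fin n → ℝ),
        (∀ v, negDefQF n (f v) = negDefQF n v) ∧ LinearMap.det f = 1 ∧
        ∀ v : Fin n → ℝ,
          involute (x : CliffordAlgebra (negDefQF n)) * ι (negDefQF n) v * ↑x⁻¹ =
            ι (negDefQF n) (f v)) ∧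
    -- ρ : Spin(n) → SO(n) is surjective
    (∀ f : (Fin n → ℝ) →ₗ[ℝ] (Fin n → ℝ),
      (∀ v, negDefQF n (f v) = negDefQF n v) → LinearMap.det f = 1 →
      ∃ x : (CliffordAlgebra (negDefQF n))ˣ, InSpin n x ∧
        ∀ v : Fin n → ℝ,
          involute (x : CliffordAlgebra (negDefQF n)) * ι (negDefQF n) v * ↑x⁻¹ =
            ι (negDefQF n) (f v)) ∧
    -- the kernel of ρ on Spin(n) is {−1, 1}
    (∀ x : (CliffordAlgebra (negDefQF n))ˣ, InSpin n x →
      ((∀ v : Fin n → ℝ,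
          involute (x : CliffordAlgebra (negDefQF n)) * ι (negDefQF n) v * ↑x⁻¹ =
            ι (negDefQF n) v) ↔
        ((x : CliffordAlgebra (negDefQF n)) = 1 ∨
          (x : CliffordAlgebra (negDefQF n)) = -1))) := by
  refine ⟨fun x y _ _ v => twistedConj_mul x y v, fun x hx => hx.exists_isometry, fun f hf => ?_,
    fun x hx => hx.twistedConj_eq_iff, fun x hx => hx.exists_isometry, exists_inSpin_of_isometry,
    fun x hx => hx.1.twistedConj_eq_iff⟩
  obtain ⟨x, -, hx, -, -, hxf⟩ := exists_inPin_of_isometry f hf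
  exact ⟨x, hx, hxf⟩
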